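/- Equivalence over words is decidable: there is a computable procedure which, given (codes of) two sentences φ and ψ over the word vocabulary W, decides whether φ and ψ have exactly the same word models (i.e., whether every word satisfies φ if and only if it satisfies ψ). -/

import Mathlib

open FirstOrder Language

/-- The word vocabulary `W`: countably many unary relation symbols `P_i` and a
single binary relation symbol `<`. -/
def W : FirstOrder.Language :=
  ⟨fun _ => Empty, fun n => match n with
    | 1 => ℕ
    | 2 => Unit
    | _ => Empty⟩

instance : ∀ n, IsEmpty (W.Functions n) := fun _ => inferInstanceAs (IsEmpty Empty)
instance : ∀ n, Encodable (W.Functions n) := fun _ => inferInstanceAs (Encodable Empty)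
instance : ∀ n, Encodable (W.Relations n)
  | 0 => inferInstanceAs (Encodable Empty)
  | 1 => inferInstanceAs (Encodable ℕ)
  | 2 => inferInstanceAs (Encodable Unit)
  | (_ + 3) => inferInstanceAs (Encodable Empty)

/-- The unary relation symbol `P_i` of `W`. -/
def unSym (i : ℕ) : W.Relations 1 := i

/-- The binary relation symbol `<` of `W`. -/
def ltSym : W.Relations 2 := Unit.unit

/-- A computable encoding of (sigma-)bounded `W`-formulas as naturals. -/
instance : Encodable (Σ n, W.BoundedFormula Empty n) :=
  Encodable.ofLeftInjection (fun φ => φ.2.listEncode)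
    (fun l => (BoundedFormula.listDecode l)[0]?)
    (fun φ => BoundedFormula.encoding.decode_encode φ)

/-- A computable encoding of `W`-sentences as naturals. -/
instance : Encodable W.Sentence :=
  Encodable.ofLeftInjection (fun φ => (⟨0, φ⟩ : Σ n, W.BoundedFormula Empty n))
    (fun p => match p with
      | ⟨0, φ⟩ => some φ
      | _ => none)
    (fun _ => rfl)

/-- A `W`-structure is a word if it is finite and nonempty, `<` is interpreted as a
strict linear order, and every element satisfies exactly one unary relation symbol. -/
def IsWord (M : Type) [W.Structure M] : Prop :=
  Finite M ∧ Nonempty M ∧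
    IsStrictTotalOrder M (fun a b => Structure.RelMap ltSym ![a, b]) ∧
    ∀ a : M, ∃! i : ℕ, Structure.RelMap (unSym i) ![a]

namespace WordLogic

/-- Formulas over words, with de Bruijn levels as variables. -/
inductive Fm : ℕ → Type
  | fls {n : ℕ} : Fm n
  | eq {n : ℕ} (i j : Fin n) : Fm n
  | lt {n : ℕ} (i j : Fin n) : Fm n
  | pr {n : ℕ} (k : ℕ) (i : Fin n) : Fm n
  | imp {n : ℕ} (φ ψ : Fm n) : Fm n
  | all {n : ℕ} (φ : Fm (n + 1)) : Fm n

/-- The term consisting of the `i`-th bound variable. -/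
def bvar {n : ℕ} (i : Fin n) : W.Term (Empty ⊕ Fin n) := Term.var (Sum.inr i)

/-- The `W`-formula denoted by an element of `Fm`. -/
def Fm.toBF : {n : ℕ} → Fm n → W.BoundedFormula Empty n
  | _, .fls => .falsum
  | _, .eq i j => .equal (bvar i) (bvar j)
  | _, .lt i j => .rel ltSym ![bvar i, bvar j]
  | _, .pr k i => .rel (unSym k) ![bvar i]
  | _, .imp φ ψ => .imp φ.toBF ψ.toBF
  | _, .all φ => .all φ.toBF

theorem exists_bvar {n : ℕ} (t : W.Term (Empty ⊕ Fin n)) : ∃ i, t = bvar i := by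
  rcases t with (a | i) | ⟨f, _⟩
  · exact a.elim
  · exact ⟨i, rfl⟩
  · exact isEmptyElim f

theorem Fm.toBF_surjective {n : ℕ} (φ : W.BoundedFormula Empty n) :
    ∃ F : Fm n, F.toBF = φ := by
  induction φ with
  | falsum => exact ⟨.fls, rfl⟩
  | equal s t =>
    obtain ⟨i, rfl⟩ := exists_bvar s
    obtain ⟨j, rfl⟩ := exists_bvar t
    exact ⟨.eq i j, rfl⟩
  | @rel n l R ts =>
    choose v hv using fun i => exists_bvar (ts i)
    match l, R, ts, v, hv with
    | 0, R, _, _, _ => exact Empty.elim R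
    | 1, R, ts, v, hv =>
      refine ⟨.pr R (v 0), ?_⟩
      have : ts = ![bvar (v 0)] := by ext i; fin_cases i; exact hv 0
      rw [this]; rfl
    | 2, R, ts, v, hv =>
      refine ⟨.lt (v 0) (v 1), ?_⟩
      have : ts = ![bvar (v 0), bvar (v 1)] := by
        ext i; fin_cases i
        · exact hv 0
        · exact hv 1
      rw [this]; rfl
    | _ + 3, R, _, _, _ => exact Empty.elim R
  | imp _ _ ih₁ ih₂ =>
    obtain ⟨F, rfl⟩ := ih₁
    obtain ⟨G, rfl⟩ := ih₂
    exact ⟨.imp F G, rfl⟩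
  | all _ ih =>
    obtain ⟨F, rfl⟩ := ih
    exact ⟨.all F, rfl⟩

/-- Satisfaction in the word of length `L` whose letter at position `p` is `f p`. -/
def Sat (L : ℕ) (f : ℕ → ℕ) : {n : ℕ} → Fm n → (ℕ → ℕ) → Prop
  | _, .fls, _ => False
  | _, .eq i j, e => e i = e j
  | _, .lt i j, e => e i < e j
  | _, .pr k i, e => f (e i) = k
  | _, .imp φ ψ, e => Sat L f φ e → Sat L f ψ e
  | n, .all φ, e => ∀ x < L, Sat L f φ (Function.update e n x)

theorem realize_toBF {M : Type} [W.Structure M] {L : ℕ} {f : ℕ → ℕ} (g : M ≃ Fin L)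
    (hlt : ∀ a b : M, Structure.RelMap ltSym ![a, b] ↔ g a < g b)
    (hpr : ∀ (a : M) (i : ℕ), Structure.RelMap (unSym i) ![a] ↔ f (g a) = i)
    {n : ℕ} (F : Fm n) (w : Empty → M) (xs : Fin n → M) (e : ℕ → ℕ)
    (he : ∀ i : Fin n, e i = g (xs i)) : F.toBF.Realize w xs ↔ Sat L f F e := by
  induction F generalizing e with
  | fls => rfl
  | eq i j =>
    simp [Fm.toBF, BoundedFormula.Realize, bvar, Sat, he, Fin.val_inj]
  | lt i j =>
    have : (fun k => ((![bvar i, bvar j] k : W.Term _).realize (Sum.elim w xs)))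
        = ![xs i, xs j] := by ext k; fin_cases k <;> rfl
    simp only [Fm.toBF, BoundedFormula.Realize, Sat, he, this, hlt, Fin.lt_def]
  | pr k i =>
    have : (fun l => ((![bvar i] l : W.Term _).realize (Sum.elim w xs)))
        = ![xs i] := by ext k; fin_cases k; rfl
    simp only [Fm.toBF, BoundedFormula.Realize, Sat, he, this, hpr]
  | imp _ _ ih₁ ih₂ =>
    simp only [Fm.toBF, BoundedFormula.Realize, Sat, ih₁ xs e he, ih₂ xs e he]
  | @all n φ ih =>
    simp only [Fm.toBF, BoundedFormula.Realize, Sat]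
    have key : ∀ a : M, φ.toBF.Realize w (Fin.snoc xs a) ↔
        Sat L f φ (Function.update e n (g a)) := by
      refine fun a => ih _ _ fun i => ?_
      refine Fin.lastCases ?_ (fun i => ?_) i
      · simp
      · simp [Function.update_of_ne i.2.ne, he]
    refine ⟨fun h x hx => ?_, fun h a => (key a).2 (h _ (g a).2)⟩
    simpa using (key (g.symm ⟨x, hx⟩)).1 (h _)

/-- The structure on `Fin L` of the word with letters `f`. -/
abbrev wordStructure (L : ℕ) (f : ℕ → ℕ) : W.Structure (Fin L) where
  funMap := fun h => isEmptyElim h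
  RelMap := fun {n} R v => match n, R, v with
    | 0, R, _ => Empty.elim R
    | 1, (i : ℕ), v => f (v 0) = i
    | 2, _, v => v 0 < v 1
    | _ + 3, R, _ => Empty.elim R

theorem forall_word_iff (F G : Fm 0) :
    (∀ (M : Type) (_ : W.Structure M), IsWord M →
      (M ⊨ (F.toBF : W.Sentence) ↔ M ⊨ (G.toBF : W.Sentence))) ↔
    ∀ L f, 0 < L → (Sat L f F 0 ↔ Sat L f G 0) := by
  constructor
  · intro h L f hL
    let := wordStructure L f
    have hlt : ∀ a b : Fin L, Structure.RelMap ltSym ![a, b] ↔ a < b := fun _ _ => Iff.rfl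
    have hpr : ∀ (a : Fin L) (i : ℕ), Structure.RelMap (unSym i) ![a] ↔ f a = i :=
      fun _ _ => Iff.rfl
    have hw : IsWord (Fin L) := by
      refine ⟨inferInstance, ⟨⟨0, hL⟩⟩, ?_, fun a => ?_⟩
      · simp only [hlt]
        exact inferInstanceAs (IsStrictTotalOrder (Fin L) (· < ·))
      · simp only [hpr]
        exact ⟨_, rfl, fun _ h => h.symm⟩
    have := h (Fin L) _ hw
    simpa only [Sentence.Realize, Formula.Realize,
      realize_toBF (Equiv.refl (Fin L)) hlt hpr _ _ _ 0 (fun i => i.elim0)] using this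
  · rintro h M _ ⟨hfin, hne, hord, hex⟩
    classical
    let := linearOrderOfSTO (fun a b : M => Structure.RelMap ltSym ![a, b])
    let := Fintype.ofFinite M
    let o := (Fintype.orderIsoFinOfCardEq M rfl).symm
    choose l hl hl' using hex
    have hf : ∀ a : M, (fun p => if h : p < Fintype.card M then l (o.symm ⟨p, h⟩) else 0) (o a)
        = l a := by simp
    have key := fun F : Fm 0 => realize_toBF (L := Fintype.card M)
      (f := fun p => if h : p < Fintype.card M then l (o.symm ⟨p, h⟩) else 0) o.toEquiv
      (fun a b => (o.lt_iff_lt (x := a) (y := b)).symm)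
      (fun a i => by
        change _ ↔ (fun p => if h : p < Fintype.card M then l (o.symm ⟨p, h⟩) else 0) (o a) = i
        rw [hf]
        exact ⟨fun h => (hl' a i h).symm, fun h => h ▸ hl a⟩) F default default 0
      (fun i => i.elim0)
    exact (key F).trans ((h _ _ Fintype.card_pos).trans (key G).symm)

/-- Letters of words whose positions are marked by sets of variables. -/
abbrev MLetter := ℕ × Set ℕ

/-- All the ways of marking one additional position by the variable `n`. -/
def marks (n : ℕ) : List MLetter → List (List MLetter)
  | [] => []
  | a :: u => ((a.1, insert n a.2) :: u) :: (marks n u).map (a :: ·)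

/-- Satisfaction in marked words, with variables ranging over sets of positions. -/
def MSat : {n : ℕ} → Fm n → List MLetter → Prop
  | _, .fls, _ => False
  | _, .eq i j, u => ∃ a ∈ u, i.1 ∈ a.2 ∧ j.1 ∈ a.2
  | _, .lt i j, u => ¬ u.Pairwise fun a b => ¬ (i.1 ∈ a.2 ∧ j.1 ∈ b.2)
  | _, .pr k i, u => ∃ a ∈ u, a.1 = k ∧ i.1 ∈ a.2
  | _, .imp φ ψ, u => MSat φ u → MSat ψ u
  | n, .all φ, u => ∀ x ∈ marks n u, MSat φ x

/-- The number of states of an automaton recognising the models of a formula. -/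
def states : {n : ℕ} → Fm n → ℕ
  | _, .fls => 1
  | _, .eq _ _ => 2
  | _, .lt _ _ => 4
  | _, .pr _ _ => 2
  | _, .imp φ ψ => states φ * states ψ
  | _, .all φ => states φ * 2 ^ states φ

theorem exists_automaton {n : ℕ} (F : Fm n) :
    ∃ (S : Type) (_ : Fintype S) (h : List MLetter → S), Fintype.card S = states F ∧
      (∀ a u v, h u = h v → h (a :: u) = h (a :: v)) ∧
      ∀ u v, h u = h v → (MSat F u ↔ MSat F v) := by
  classical
  induction F with
  | fls => exact ⟨Unit, inferInstance, fun _ => (), rfl, fun _ _ _ _ => rfl, fun _ _ _ => Iff.rfl⟩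
  | eq i j =>
    refine ⟨Prop, inferInstance, fun u => MSat (.eq i j) u, by simp [states], ?_, ?_⟩
    · intro a u v h
      simp only [MSat, List.mem_cons, exists_eq_or_imp, eq_iff_iff] at h ⊢
      rw [h]
    · exact fun u v h => iff_of_eq h
  | lt i j =>
    refine ⟨Prop × Prop, inferInstance, fun u => (∃ a ∈ u, j.1 ∈ a.2, MSat (.lt i j) u),
      by simp [states], ?_, ?_⟩
    · intro a u v h
      simp only [MSat, List.mem_cons, exists_eq_or_imp, Prod.mk.injEq, eq_iff_iff,
        List.pairwise_cons, not_and_or, not_iff_not] at h ⊢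
      refine ⟨by rw [h.1], ?_⟩
      rw [h.2]
      refine or_congr_left ?_
      by_cases hi : i.1 ∈ a.2
      · simpa [hi] using h.1
      · simp [hi]
    · exact fun u v h => iff_of_eq (congrArg Prod.snd h)
  | pr k i =>
    refine ⟨Prop, inferInstance, fun u => MSat (.pr k i) u, by simp [states], ?_, ?_⟩
    · intro a u v h
      simp only [MSat, List.mem_cons, exists_eq_or_imp, eq_iff_iff] at h ⊢
      rw [h]
    · exact fun u v h => iff_of_eq h
  | imp φ ψ ih₁ ih₂ =>
    obtain ⟨S, _, h₁, hc₁, hs₁, hm₁⟩ := ih₁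
    obtain ⟨T, _, h₂, hc₂, hs₂, hm₂⟩ := ih₂
    refine ⟨S × T, inferInstance, fun u => (h₁ u, h₂ u), by simp [states, hc₁, hc₂], ?_, ?_⟩
    · intro a u v h
      simp only [Prod.mk.injEq] at h ⊢
      exact ⟨hs₁ _ _ _ h.1, hs₂ _ _ _ h.2⟩
    · intro u v h
      simp only [Prod.mk.injEq] at h
      exact imp_congr (hm₁ _ _ h.1) (hm₂ _ _ h.2)
  | @all n φ ih =>
    obtain ⟨S, _, h, hc, hs, hm⟩ := ih
    refine ⟨S × Set S, inferInstance, fun u => (h u, {s | ∃ x ∈ marks n u, h x = s}),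
      by simp [states, hc], ?_, ?_⟩
    · intro a u v huv
      simp only [Prod.mk.injEq] at huv ⊢
      refine ⟨hs _ _ _ huv.1, ?_⟩
      have aux : ∀ u v : List MLetter, h u = h v →
          {s | ∃ x ∈ marks n u, h x = s} = {s | ∃ x ∈ marks n v, h x = s} →
          ∀ s, (∃ x ∈ marks n (a :: u), h x = s) → ∃ x ∈ marks n (a :: v), h x = s := by
        rintro u v h₁ h₂ s ⟨x, hx, rfl⟩
        simp only [marks, List.mem_cons, List.mem_map] at hx
        rcases hx with rfl | ⟨y, hy, rfl⟩
        · exact ⟨_, by simp [marks], (hs _ _ _ h₁).symm⟩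
        · have : h y ∈ {s | ∃ x ∈ marks n v, h x = s} := h₂ ▸ ⟨y, hy, rfl⟩
          obtain ⟨z, hz, hzy⟩ := this
          exact ⟨a :: z, by simp [marks, hz], hs _ _ _ hzy⟩
      ext s
      exact ⟨aux u v huv.1 huv.2 s, aux v u huv.1.symm huv.2.symm s⟩
    · have aux : ∀ u v : List MLetter,
          {s | ∃ x ∈ marks n u, h x = s} = {s | ∃ x ∈ marks n v, h x = s} →
          MSat (.all φ) u → MSat (.all φ) v := by
        intro u v h₂ hu x hx
        have : h x ∈ {s | ∃ x ∈ marks n u, h x = s} := h₂ ▸ ⟨x, hx, rfl⟩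
        obtain ⟨y, hy, hyx⟩ := this
        exact (hm _ _ hyx).1 (hu y hy)
      intro u v huv
      simp only [Prod.mk.injEq] at huv
      exact ⟨aux u v huv.2, aux v u huv.2.symm⟩

/-- Pumping: a nonempty word distinguishing two formulas can be shortened. -/
theorem exists_short {n m : ℕ} (F : Fm n) (G : Fm m) (u : List MLetter) (hu : u ≠ [])
    (h : ¬ (MSat F u ↔ MSat G u)) :
    ∃ v : List MLetter, v ≠ [] ∧ v.length ≤ states F * states G ∧ v ⊆ u ∧
      ¬ (MSat F v ↔ MSat G v) := by
  obtain ⟨S, _, h₁, hc₁, hs₁, hm₁⟩ := exists_automaton F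
  obtain ⟨T, _, h₂, hc₂, hs₂, hm₂⟩ := exists_automaton G
  induction hl : u.length using Nat.strong_induction_on generalizing u with
  | _ l ih =>
    subst hl
    by_cases hle : u.length ≤ states F * states G
    · exact ⟨u, hu, hle, fun _ h => h, h⟩
    have hcard : Fintype.card (S × T) < Fintype.card (Fin u.length) := by
      simpa [hc₁, hc₂] using hle
    obtain ⟨i, j, hij, hh⟩ := Fintype.exists_ne_map_eq_of_card_lt
      (fun i : Fin u.length => (h₁ (u.drop i), h₂ (u.drop i))) hcard
    wlog hlt : i < j generalizing i j
    · exact this j i hij.symm hh.symm (lt_of_le_of_ne (not_lt.1 hlt) hij.symm)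
    simp only [Prod.mk.injEq] at hh
    have hcong : ∀ {S : Type} (h : List MLetter → S),
        (∀ a u v, h u = h v → h (a :: u) = h (a :: v)) →
        ∀ x u v, h u = h v → h (x ++ u) = h (x ++ v) := by
      intro S h hs x u v huv
      induction x with
      | nil => exact huv
      | cons a x ih => exact hs _ _ _ ih
    set v := u.take i ++ u.drop j with hv
    have e₁ : h₁ u = h₁ v := by
      conv_lhs => rw [← List.take_append_drop i u]
      exact hcong h₁ hs₁ _ _ _ hh.1
    have e₂ : h₂ u = h₂ v := by
      conv_lhs => rw [← List.take_append_drop i u]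
      exact hcong h₂ hs₂ _ _ _ hh.2
    have hlen : v.length < u.length := by
      simp only [hv, List.length_append, List.length_take, List.length_drop]
      have := j.2
      omega
    have hpos : v ≠ [] := by
      rw [← List.length_pos_iff]
      simp only [hv, List.length_append, List.length_take, List.length_drop]
      have := j.2
      omega
    obtain ⟨x, hx, hxl, hxs, hxn⟩ := ih _ hlen v hpos (by rwa [← hm₁ _ _ e₁, ← hm₂ _ _ e₂]) rfl
    refine ⟨x, hx, hxl, fun a ha => ?_, hxn⟩
    have := hxs ha
    rw [hv, List.mem_append] at this
    exact this.elim List.mem_of_mem_take List.mem_of_mem_drop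

theorem mem_marks {n : ℕ} {u x : List MLetter} :
    x ∈ marks n u ↔ ∃ p < u.length, x = u.modify p fun a => (a.1, insert n a.2) := by
  induction u generalizing x with
  | nil => simp [marks]
  | cons a u ih =>
    simp only [marks, List.mem_cons, List.mem_map, ih, List.length_cons]
    constructor
    · rintro (rfl | ⟨y, ⟨p, hp, rfl⟩, rfl⟩)
      · exact ⟨0, by simp⟩
      · exact ⟨p + 1, by simpa⟩
    · rintro ⟨_ | p, hp, rfl⟩
      · simp
      · exact .inr ⟨_, ⟨p, by simpa using hp, rfl⟩, by simp⟩

theorem mSat_iff_sat {n : ℕ} (F : Fm n) (u : List MLetter) (f e : ℕ → ℕ)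
    (he : ∀ i < n, e i < u.length)
    (hu : ∀ (p : ℕ) (h : p < u.length), u[p].1 = f p ∧ ∀ i, (i ∈ u[p].2 ↔ i < n ∧ e i = p)) :
    MSat F u ↔ Sat u.length f F e := by
  induction F generalizing u e with
  | fls => rfl
  | eq i j =>
    simp only [MSat, Sat, List.mem_iff_getElem]
    constructor
    · rintro ⟨a, ⟨p, hp, rfl⟩, hi, hj⟩
      rw [(((hu p hp).2 i).1 hi).2, (((hu p hp).2 j).1 hj).2]
    · intro h
      have hp := he i i.2
      exact ⟨_, ⟨e i, hp, rfl⟩, ((hu _ hp).2 i).2 ⟨i.2, rfl⟩, ((hu _ hp).2 j).2 ⟨j.2, h.symm⟩⟩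
  | lt i j =>
    simp only [MSat, Sat, List.pairwise_iff_getElem]
    push Not
    constructor
    · rintro ⟨p, q, hp, hq, hpq, hi, hj⟩
      rwa [(((hu p hp).2 i).1 hi).2, (((hu q hq).2 j).1 hj).2]
    · intro h
      have hp := he i i.2
      have hq := he j j.2
      exact ⟨e i, e j, hp, hq, h, ((hu _ hp).2 i).2 ⟨i.2, rfl⟩, ((hu _ hq).2 j).2 ⟨j.2, rfl⟩⟩
  | pr k i =>
    simp only [MSat, Sat, List.mem_iff_getElem]
    constructor
    · rintro ⟨a, ⟨p, hp, rfl⟩, hk, hi⟩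
      rw [(((hu p hp).2 i).1 hi).2, ← hk, (hu p hp).1]
    · intro h
      have hp := he i i.2
      exact ⟨_, ⟨e i, hp, rfl⟩, (hu _ hp).1.trans h, ((hu _ hp).2 i).2 ⟨i.2, rfl⟩⟩
  | imp φ ψ ih₁ ih₂ => exact imp_congr (ih₁ u e he hu) (ih₂ u e he hu)
  | @all n φ ih =>
    simp only [MSat, Sat, mem_marks]
    have key : ∀ x < u.length, MSat φ (u.modify x fun a => (a.1, insert n a.2)) ↔
        Sat u.length f φ (Function.update e n x) := by
      intro x hx
      have := ih (u.modify x fun a => (a.1, insert n a.2)) (Function.update e n x) ?_ ?_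
      · simpa using this
      · intro i hi
        rcases eq_or_ne i n with rfl | hne
        · simpa using hx
        · simpa [hne] using he i (by omega)
      · intro p hp
        have hp' : p < u.length := by simpa using hp
        obtain ⟨h₁, h₂⟩ := hu p hp'
        rw [List.getElem_modify]
        refine ⟨by split_ifs <;> simpa using h₁, fun i => ?_⟩
        have h₂ := h₂ i
        rcases eq_or_ne i n with rfl | hne
        · have h₃ : i ∉ u[p].2 := fun h => (lt_irrefl _ (h₂.1 h).1)
          split_ifs with hxp <;> simp [hxp, h₃]
        · have h₃ : i < n + 1 ↔ i < n := by omega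
          split_ifs with hxp <;> simp [hne, h₂, h₃]
    constructor
    · exact fun h x hx => (key x hx).1 (h _ ⟨x, hx, rfl⟩)
    · rintro h _ ⟨x, hx, rfl⟩
      exact (key x hx).2 (h x hx)

/-- An upper bound for the letters that occur in a formula. -/
def letterBound : {n : ℕ} → Fm n → ℕ
  | _, .fls => 0
  | _, .eq _ _ => 0
  | _, .lt _ _ => 0
  | _, .pr k _ => k + 1
  | _, .imp φ ψ => max (letterBound φ) (letterBound ψ)
  | _, .all φ => letterBound φ

theorem Sat.congr {L B : ℕ} {f f' : ℕ → ℕ} (hf : ∀ p < L, ∀ k < B, f p = k ↔ f' p = k)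
    {n : ℕ} {F : Fm n} (hF : letterBound F ≤ B) {e e' : ℕ → ℕ} (he : ∀ i < n, e i = e' i)
    (hL : ∀ i < n, e i < L) : Sat L f F e ↔ Sat L f' F e' := by
  induction F generalizing e e' with
  | fls => rfl
  | eq i j => simp only [Sat, he i i.2, he j j.2]
  | lt i j => simp only [Sat, he i i.2, he j j.2]
  | pr k i => simp only [Sat, ← he i i.2, hf _ (hL i i.2) k hF]
  | imp φ ψ ih₁ ih₂ =>
    exact imp_congr (ih₁ (le_of_max_le_left hF) he hL) (ih₂ (le_of_max_le_right hF) he hL)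
  | @all n φ ih =>
    refine forall₂_congr fun x hx => ih hF (fun i hi => ?_) fun i hi => ?_
    · rcases eq_or_ne i n with rfl | hne
      · simp
      · simpa [hne] using he i (by omega)
    · rcases eq_or_ne i n with rfl | hne
      · simpa
      · simpa [hne] using hL i (by omega)

/-- The `p`-th digit of `c` in base `b`. -/
def dig (b c p : ℕ) : ℕ := c / b ^ p % b

theorem dig_lt {b : ℕ} (hb : 0 < b) (c p : ℕ) : dig b c p < b := Nat.mod_lt _ hb

theorem dig_add_mul_pow_self {b c x n : ℕ} (hc : c < b ^ n) (hx : x < b) :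
    dig b (c + x * b ^ n) n = x := by
  rw [dig, Nat.add_mul_div_right _ _ (by omega), Nat.div_eq_of_lt hc, zero_add,
    Nat.mod_eq_of_lt hx]

theorem dig_add_mul_pow_of_lt {b c x n i : ℕ} (hb : 0 < b) (hi : i < n) :
    dig b (c + x * b ^ n) i = dig b c i := by
  obtain ⟨k, rfl⟩ := Nat.exists_eq_add_of_lt hi
  have : x * b ^ (i + k + 1) = x * b ^ k * b * b ^ i := by ring
  rw [dig, this, Nat.add_mul_div_right _ _ (by positivity), Nat.add_mul_mod_self_right, dig]

theorem add_mul_pow_lt {b c x n : ℕ} (hc : c < b ^ n) (hx : x < b) :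
    c + x * b ^ n < b ^ (n + 1) := by
  calc c + x * b ^ n < b ^ n + x * b ^ n := by omega
    _ = (x + 1) * b ^ n := by ring
    _ ≤ b * b ^ n := Nat.mul_le_mul_right _ hx
    _ = b ^ (n + 1) := by ring

theorem exists_dig {b : ℕ} {f : ℕ → ℕ} (hf : ∀ p, f p < b) (L : ℕ) :
    ∃ c < b ^ L, ∀ p < L, dig b c p = f p := by
  induction L with
  | zero => exact ⟨0, by simp⟩
  | succ L ih =>
    obtain ⟨c, hc, h⟩ := ih
    refine ⟨c + f L * b ^ L, add_mul_pow_lt hc (hf L), fun p hp => ?_⟩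
    rcases Nat.lt_succ_iff_lt_or_eq.1 hp with hp | rfl
    · rw [dig_add_mul_pow_of_lt (by have := hf L; omega) hp, h p hp]
    · exact dig_add_mul_pow_self hc (hf p)

theorem forall_sat_iff_bounded (F G : Fm 0) :
    (∀ L f, 0 < L → (Sat L f F 0 ↔ Sat L f G 0)) ↔
    ∀ L < states F * states G + 1, 0 < L →
      ∀ c < (max (letterBound F) (letterBound G) + 1) ^ L,
        (Sat L (dig (max (letterBound F) (letterBound G) + 1) c) F 0 ↔
          Sat L (dig (max (letterBound F) (letterBound G) + 1) c) G 0) := by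
  refine ⟨fun h L _ hL c _ => h L _ hL, fun h L f hL => ?_⟩
  by_contra hne
  set u : List MLetter := List.ofFn fun p : Fin L => (f p, ∅) with hu
  have hlen : u.length = L := by simp [hu]
  have hMu : ∀ F : Fm 0, MSat F u ↔ Sat L f F 0 := by
    intro F
    have := mSat_iff_sat F u f 0 (by simp) (by simp [hu])
    rwa [hlen] at this
  obtain ⟨v, hv, hvl, hvu, hvn⟩ := exists_short F G u (by rw [← List.length_pos_iff]; omega)
    (by rwa [hMu, hMu])
  have hempty : ∀ a ∈ v, a.2 = ∅ := by
    intro a ha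
    have := hvu ha
    rw [hu, List.mem_ofFn] at this
    obtain ⟨_, rfl⟩ := this
    rfl
  let f' : ℕ → ℕ := fun p => (v.getD p (0, ∅)).1
  have hMv : ∀ F : Fm 0, MSat F v ↔ Sat v.length f' F 0 := by
    intro F
    refine mSat_iff_sat F v f' 0 (by simp) fun p hp => ⟨by simp [f', hp], fun i => ?_⟩
    simp [hempty _ (List.getElem_mem hp)]
  rw [hMv, hMv] at hvn
  set B := max (letterBound F) (letterBound G)
  obtain ⟨c, hc, hcf⟩ := exists_dig (b := B + 1) (f := fun p => min (f' p) B) (by omega) v.length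
  have hcong : ∀ p < v.length, ∀ k < B, f' p = k ↔ dig (B + 1) c p = k := by
    intro p hp k hk
    rw [hcf p hp]
    omega
  rw [Sat.congr hcong (le_max_left _ _) (e' := 0) (by simp) (by simp),
    Sat.congr hcong (le_max_right _ _) (e' := 0) (by simp) (by simp)] at hvn
  exact hvn (h _ (by omega) (List.length_pos_iff.2 hv) c hc)

/-- The code of a term consisting of the `i`-th of `n` variables. -/
def termTok (n i : ℕ) : ℕ := 2 * Nat.pair n (Nat.pair (2 * (2 * i + 1)) 0 + 1)

/-- The code of the formula as a list of symbols. -/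
def tok : {n : ℕ} → Fm n → List ℕ
  | n, .fls => [4 * (n + 2) + 3]
  | n, .eq i j => [termTok n i, termTok n j]
  | n, .lt i j => [4 * Nat.pair 2 0 + 1, 4 * n + 3, termTok n i, termTok n j]
  | n, .pr k i => [4 * Nat.pair 1 k + 1, 4 * n + 3, termTok n i]
  | _, .imp φ ψ => 3 :: (tok φ ++ tok ψ)
  | _, .all φ => 7 :: tok φ

theorem encode_list_map {α : Type*} [Encodable α] (l : List α) :
    Encodable.encode (l.map Encodable.encode) = Encodable.encode l := by
  induction l with
  | nil => rfl
  | cons a l ih => simp only [List.map_cons, Encodable.encode_list_cons, ih, Encodable.encode_nat]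

theorem map_encode_listEncode {n : ℕ} (F : Fm n) :
    F.toBF.listEncode.map Encodable.encode = tok F := by
  have hterm : ∀ {n : ℕ} (i : Fin n), Encodable.encode (Sum.inl ⟨n, bvar i⟩ :
      (Σ k, W.Term (Empty ⊕ Fin k)) ⊕ ((Σ n, W.Relations n) ⊕ ℕ)) = termTok n i :=
    fun _ => rfl
  have hnat : ∀ m : ℕ, Encodable.encode (Sum.inr (Sum.inr m) :
      (Σ k, W.Term (Empty ⊕ Fin k)) ⊕ ((Σ n, W.Relations n) ⊕ ℕ)) = 4 * m + 3 := by
    intro m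
    change 2 * (2 * m + 1) + 1 = _
    ring
  have hrel : ∀ (l : ℕ) (R : W.Relations l), Encodable.encode (Sum.inr (Sum.inl ⟨l, R⟩) :
      (Σ k, W.Term (Empty ⊕ Fin k)) ⊕ ((Σ n, W.Relations n) ⊕ ℕ)) =
        4 * Nat.pair l (Encodable.encode R) + 1 := by
    intro l R
    change 2 * (2 * Nat.pair l _) + 1 = _
    ring
  induction F with
  | fls => simp only [Fm.toBF, BoundedFormula.listEncode, List.map_cons, hnat, tok, List.map_nil]
  | eq i j =>
    simp only [Fm.toBF, BoundedFormula.listEncode, List.map_cons, hterm, tok, List.map_nil]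
  | lt i j =>
    simp only [Fm.toBF, BoundedFormula.listEncode, List.map_cons, hnat, hrel, tok, List.map_nil,
      List.map_append, List.finRange_succ, List.finRange_zero]
    rfl
  | pr k i =>
    simp only [Fm.toBF, BoundedFormula.listEncode, List.map_cons, hnat, hrel, tok, List.map_nil,
      List.map_append, List.finRange_succ, List.finRange_zero]
    rfl
  | imp φ ψ ih₁ ih₂ =>
    simp only [Fm.toBF, BoundedFormula.listEncode, List.map_cons, hnat, tok, List.map_append, ih₁,
      ih₂]
    rfl
  | all φ ih =>
    simp only [Fm.toBF, BoundedFormula.listEncode, List.map_cons, hnat, tok, ih]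

theorem encode_toBF (F : Fm 0) :
    Encodable.encode (F.toBF : W.Sentence) = Encodable.encode (tok F) := by
  rw [← map_encode_listEncode, encode_list_map]
  rfl

section Primrec

attribute [fun_prop] Primrec PrimrecPred

attribute [fun_prop] Primrec.id Primrec.const Primrec.comp Primrec.fst Primrec.snd
  Primrec.pair Primrec.ite PrimrecPred.comp PrimrecPred.and PrimrecPred.not Primrec.list_tail
  Primrec.list_headI Primrec.list_length Primrec.unpair

variable {α β : Type*} [Primcodable α] [Primcodable β] {f g : α → ℕ}

@[fun_prop]
theorem primrec_add (hf : Primrec f) (hg : Primrec g) : Primrec fun a => f a + g a :=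
  Primrec.nat_add.comp hf hg

@[fun_prop]
theorem primrec_sub (hf : Primrec f) (hg : Primrec g) : Primrec fun a => f a - g a :=
  Primrec.nat_sub.comp hf hg

@[fun_prop]
theorem primrec_mul (hf : Primrec f) (hg : Primrec g) : Primrec fun a => f a * g a :=
  Primrec.nat_mul.comp hf hg

@[fun_prop]
theorem primrec_div (hf : Primrec f) (hg : Primrec g) : Primrec fun a => f a / g a :=
  Primrec.nat_div.comp hf hg

@[fun_prop]
theorem primrec_mod (hf : Primrec f) (hg : Primrec g) : Primrec fun a => f a % g a :=
  Primrec.nat_mod.comp hf hg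

@[fun_prop]
theorem primrec_pow (hf : Primrec f) (hg : Primrec g) : Primrec fun a => f a ^ g a :=
  (Primrec₂.unpaired'.1 Nat.Primrec.pow).comp hf hg

@[fun_prop]
theorem primrec_max (hf : Primrec f) (hg : Primrec g) : Primrec fun a => max (f a) (g a) :=
  Primrec.nat_max.comp hf hg

@[fun_prop]
theorem primrec_natPair (hf : Primrec f) (hg : Primrec g) : Primrec fun a => Nat.pair (f a) (g a) :=
  Primrec₂.natPair.comp hf hg

@[fun_prop]
theorem primrecPred_lt (hf : Primrec f) (hg : Primrec g) : PrimrecPred fun a => f a < g a :=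
  Primrec.nat_lt.comp hf hg

@[fun_prop]
theorem primrecPred_le (hf : Primrec f) (hg : Primrec g) : PrimrecPred fun a => f a ≤ g a :=
  Primrec.nat_le.comp hf hg

@[fun_prop]
theorem primrecPred_eq {f g : α → β} (hf : Primrec f) (hg : Primrec g) :
    PrimrecPred fun a => f a = g a :=
  Primrec.eq.comp hf hg

@[fun_prop]
theorem primrec_cons {f : α → β} {g : α → List β} (hf : Primrec f) (hg : Primrec g) :
    Primrec fun a => f a :: g a :=
  Primrec.list_cons.comp hf hg

@[fun_prop]
theorem primrec_append {f g : α → List β} (hf : Primrec f) (hg : Primrec g) :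
    Primrec fun a => f a ++ g a :=
  Primrec.list_append.comp hf hg

theorem primrecPred_imp {p q : α → Prop} (hp : PrimrecPred p) (hq : PrimrecPred q) :
    PrimrecPred fun a => p a → q a := by
  classical
  exact (hp.not.or hq).of_eq fun a => imp_iff_not_or.symm

theorem primrecPred_iff {p q : α → Prop} (hp : PrimrecPred p) (hq : PrimrecPred q) :
    PrimrecPred fun a => p a ↔ q a :=
  ((primrecPred_imp hp hq).and (primrecPred_imp hq hp)).of_eq fun _ =>
    iff_iff_implies_and_implies.symm

theorem primrecPred_forall_lt {R : ℕ → α → Prop} (hf : Primrec f)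
    (hR : PrimrecPred fun p : ℕ × α => R p.1 p.2) : PrimrecPred fun a => ∀ x < f a, R x a :=
  ((PrimrecRel.forall_mem_list (R := R) hR).comp (Primrec.list_range.comp hf) .id).of_eq (by simp)

theorem primrecPred_mem {g : α → List ℕ} (hf : Primrec f) (hg : Primrec g) :
    PrimrecPred fun a => f a ∈ g a :=
  ((PrimrecRel.exists_mem_list (R := (· = ·)) (Primrec.eq (α := ℕ))).comp hg hf).of_eq (by simp)

theorem primrec_filter_range {R : ℕ → α → Prop} [DecidableRel R] (hf : Primrec f)
    (hR : PrimrecPred fun p : ℕ × α => R p.1 p.2) :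
    Primrec fun a => (List.range (f a)).filter fun e => R e a :=
  (PrimrecRel.listFilter (R := R) hR).comp (Primrec.list_range.comp hf) .id

/-- A word is coded by its length, a base, and a number whose digits in that base are the
letters of the word. -/
abbrev WordCode := ℕ × ℕ × ℕ

/-- The data computed from a formula in a given word: the number of free variables, the code of
the formula, the number of states and the bound for the letters, and the list of the codes of the
satisfying assignments. -/
abbrev Val := ℕ × List ℕ × (ℕ × ℕ) × List ℕ

/-- The value of `Fm.fls`. -/
def flsVal (n : ℕ) : Val := (n, [4 * (n + 2) + 3], (1, 0), [])

/-- The value of `Fm.eq`. -/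
def eqVal (w : WordCode) (n i j : ℕ) : Val :=
  (n, [termTok n i, termTok n j], (2, 0),
    (List.range (w.1 ^ n)).filter fun e => dig w.1 e i = dig w.1 e j)

/-- The value of `Fm.lt`. -/
def ltVal (w : WordCode) (n i j : ℕ) : Val :=
  (n, [4 * Nat.pair 2 0 + 1, 4 * n + 3, termTok n i, termTok n j], (4, 0),
    (List.range (w.1 ^ n)).filter fun e => dig w.1 e i < dig w.1 e j)

/-- The value of `Fm.pr`. -/
def prVal (w : WordCode) (n k i : ℕ) : Val :=
  (n, [4 * Nat.pair 1 k + 1, 4 * n + 3, termTok n i], (2, k + 1),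
    (List.range (w.1 ^ n)).filter fun e => dig w.2.1 w.2.2 (dig w.1 e i) = k)

/-- The value of `Fm.imp`. -/
def impVal (w : WordCode) (x y : Val) : Val :=
  (x.1, 3 :: (x.2.1 ++ y.2.1), (x.2.2.1.1 * y.2.2.1.1, max x.2.2.1.2 y.2.2.1.2),
    (List.range (w.1 ^ x.1)).filter fun e => e ∈ x.2.2.2 → e ∈ y.2.2.2)

/-- The value of `Fm.all`. -/
def allVal (w : WordCode) (x : Val) : Val :=
  (x.1 - 1, 7 :: x.2.1, (x.2.2.1.1 * 2 ^ x.2.2.1.1, x.2.2.1.2),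
    (List.range (w.1 ^ (x.1 - 1))).filter fun e => ∀ q < w.1, e + q * w.1 ^ (x.1 - 1) ∈ x.2.2.2)

@[fun_prop]
theorem primrec_dig {h : α → ℕ} (hf : Primrec f) (hg : Primrec g) (hh : Primrec h) :
    Primrec fun a => dig (f a) (g a) (h a) := by
  unfold dig; fun_prop

@[fun_prop]
theorem primrec_termTok (hf : Primrec f) (hg : Primrec g) :
    Primrec fun a => termTok (f a) (g a) := by
  unfold termTok; fun_prop

@[fun_prop]
theorem primrec_flsVal (hf : Primrec f) : Primrec fun a => flsVal (f a) := by
  unfold flsVal; fun_prop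

@[fun_prop]
theorem primrec_eqVal {w : α → WordCode} {h : α → ℕ} (hw : Primrec w) (hf : Primrec f)
    (hg : Primrec g) (hh : Primrec h) : Primrec fun a => eqVal (w a) (f a) (g a) (h a) := by
  have := primrec_filter_range (f := fun a => (w a).1 ^ f a)
    (R := fun e a => dig (w a).1 e (g a) = dig (w a).1 e (h a)) (by fun_prop) (by fun_prop)
  unfold eqVal; fun_prop

@[fun_prop]
theorem primrec_ltVal {w : α → WordCode} {h : α → ℕ} (hw : Primrec w) (hf : Primrec f)
    (hg : Primrec g) (hh : Primrec h) : Primrec fun a => ltVal (w a) (f a) (g a) (h a) := by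
  have := primrec_filter_range (f := fun a => (w a).1 ^ f a)
    (R := fun e a => dig (w a).1 e (g a) < dig (w a).1 e (h a)) (by fun_prop) (by fun_prop)
  unfold ltVal; fun_prop

@[fun_prop]
theorem primrec_prVal {w : α → WordCode} {h : α → ℕ} (hw : Primrec w) (hf : Primrec f)
    (hg : Primrec g) (hh : Primrec h) : Primrec fun a => prVal (w a) (f a) (g a) (h a) := by
  have := primrec_filter_range (f := fun a => (w a).1 ^ f a)
    (R := fun e a => dig (w a).2.1 (w a).2.2 (dig (w a).1 e (h a)) = g a)
    (by fun_prop) (by fun_prop)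
  unfold prVal; fun_prop

@[fun_prop]
theorem primrec_impVal {w : α → WordCode} {x y : α → Val} (hw : Primrec w) (hx : Primrec x)
    (hy : Primrec y) : Primrec fun a => impVal (w a) (x a) (y a) := by
  have := primrec_filter_range (f := fun a => (w a).1 ^ (x a).1)
    (R := fun e a => e ∈ (x a).2.2.2 → e ∈ (y a).2.2.2)
    (by fun_prop)
    (primrecPred_imp (primrecPred_mem (by fun_prop) (by fun_prop))
      (primrecPred_mem (by fun_prop) (by fun_prop)))
  unfold impVal; fun_prop

@[fun_prop]
theorem primrec_allVal {w : α → WordCode} {x : α → Val} (hw : Primrec w) (hx : Primrec x) :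
    Primrec fun a => allVal (w a) (x a) := by
  have := primrec_filter_range (f := fun a => (w a).1 ^ ((x a).1 - 1))
    (R := fun e a => ∀ q < (w a).1, e + q * (w a).1 ^ ((x a).1 - 1) ∈ (x a).2.2.2)
    (by fun_prop)
    (primrecPred_forall_lt
      (R := fun q (p : ℕ × α) => p.1 + q * (w p.2).1 ^ ((x p.2).1 - 1) ∈ (x p.2).2.2.2)
      (by fun_prop) (primrecPred_mem (by fun_prop) (by fun_prop)))
  unfold allVal; fun_prop

/-- The number of variables of a term, given its code. -/
def termArity (t : ℕ) : ℕ := (t / 2).unpair.1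

/-- The variable of a term, given its code. -/
def termVar (t : ℕ) : ℕ := ((t / 2).unpair.2 - 1).unpair.1 / 4

@[fun_prop]
theorem primrec_termArity (hf : Primrec f) : Primrec fun a => termArity (f a) := by
  unfold termArity; fun_prop

@[fun_prop]
theorem primrec_termVar (hf : Primrec f) : Primrec fun a => termVar (f a) := by
  unfold termVar; fun_prop

/-- One step of the parser: computes the values of the formulas coded by `t :: l` from the list
`S` of the values of the formulas coded by all the suffixes of `l`. -/
def parseStep (w : WordCode) (t : ℕ) (l : List ℕ) (S : List (List Val)) : List Val :=
  if t % 2 = 0 then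
    if termVar t < termArity t ∧ termVar l.headI < termArity t then
      eqVal w (termArity t) (termVar t) (termVar l.headI) :: S.tail.headI
    else []
  else if t % 4 = 1 then
    if (t / 4).unpair.1 = 1 then
      if termVar l.tail.headI < l.headI / 4 then
        prVal w (l.headI / 4) (t / 4).unpair.2 (termVar l.tail.headI) :: S.tail.tail.headI
      else []
    else if termVar l.tail.headI < l.headI / 4 ∧ termVar l.tail.tail.headI < l.headI / 4 then
      ltVal w (l.headI / 4) (termVar l.tail.headI) (termVar l.tail.tail.headI) ::
        S.tail.tail.tail.headI
    else []
  else if t / 4 = 0 then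
    if 2 ≤ S.headI.length ∧ S.headI.headI.1 = S.headI.tail.headI.1 then
      impVal w S.headI.headI S.headI.tail.headI :: S.headI.tail.tail
    else []
  else if t / 4 = 1 then
    if 1 ≤ S.headI.length ∧ 1 ≤ S.headI.headI.1 then
      allVal w S.headI.headI :: S.headI.tail
    else []
  else flsVal (t / 4 - 2) :: S.headI

/-- The values in `w` of the formulas coded by all the suffixes of a list. -/
def parseTable (w : WordCode) : List ℕ → List (List Val)
  | [] => [ [] ]
  | t :: l => parseStep w t l (parseTable w l) :: parseTable w l

theorem primrec_parseStep {w : α → WordCode} {l : α → List ℕ} {S : α → List (List Val)}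
    (hw : Primrec w) (hf : Primrec f) (hl : Primrec l) (hS : Primrec S) :
    Primrec fun a => parseStep (w a) (f a) (l a) (S a) := by
  unfold parseStep
  fun_prop

@[fun_prop]
theorem primrec_parseTable {w : α → WordCode} {l : α → List ℕ} (hw : Primrec w)
    (hl : Primrec l) : Primrec fun a => parseTable (w a) (l a) := by
  have := Primrec.list_rec (h := fun a (p : ℕ × List ℕ × List (List Val)) =>
    parseStep (w a) p.1 p.2.1 p.2.2 :: p.2.2) hl (Primrec.const [ [] ])
    (primrec_cons (primrec_parseStep (by fun_prop) (by fun_prop) (by fun_prop) (by fun_prop))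
      (by fun_prop))
  refine this.of_eq fun a => ?_
  induction l a with
  | nil => rfl
  | cons t l ih => simp only [parseTable, ← ih]

/-- The value in the word `w` of the sentence with code `c`. -/
def codeVal (w : WordCode) (c : ℕ) : Val :=
  (parseTable w (Denumerable.ofNat (List ℕ) c)).headI.headI

@[fun_prop]
theorem primrec_codeVal {w : α → WordCode} (hw : Primrec w) (hf : Primrec f) :
    Primrec fun a => codeVal (w a) (f a) := by
  have := (Primrec.ofNat (List ℕ)).comp hf
  unfold codeVal; fun_prop

/-- `c` is the code of a sentence. -/
def IsCode (c : ℕ) : Prop :=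
  Denumerable.ofNat (List ℕ) c ≠ [] ∧ (codeVal (0, 0, 0) c).1 = 0 ∧
    (codeVal (0, 0, 0) c).2.1 = Denumerable.ofNat (List ℕ) c

/-- The sentences with codes `c` and `d` agree on all words up to a computed size. -/
def AgreeBounded (c d : ℕ) : Prop :=
  ∀ L < (codeVal (0, 0, 0) c).2.2.1.1 * (codeVal (0, 0, 0) d).2.2.1.1 + 1, 0 < L →
    ∀ u < (max (codeVal (0, 0, 0) c).2.2.1.2 (codeVal (0, 0, 0) d).2.2.1.2 + 1) ^ L,
      (0 ∈ (codeVal (L, max (codeVal (0, 0, 0) c).2.2.1.2 (codeVal (0, 0, 0) d).2.2.1.2 + 1, u)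
          c).2.2.2 ↔
        0 ∈ (codeVal (L, max (codeVal (0, 0, 0) c).2.2.1.2 (codeVal (0, 0, 0) d).2.2.1.2 + 1, u)
          d).2.2.2)

theorem primrecPred_isCode (hf : Primrec f) : PrimrecPred fun a => IsCode (f a) := by
  have := (Primrec.ofNat (List ℕ)).comp hf
  unfold IsCode; fun_prop

theorem primrecPred_agreeBounded (hf : Primrec f) (hg : Primrec g) :
    PrimrecPred fun a => AgreeBounded (f a) (g a) := by
  unfold AgreeBounded
  refine primrecPred_forall_lt (by fun_prop) (primrecPred_imp (by fun_prop) ?_)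
  refine primrecPred_forall_lt (α := ℕ × α) (by fun_prop) (primrecPred_iff ?_ ?_) <;>
  exact primrecPred_mem (by fun_prop) (by fun_prop)

end Primrec

/-- The value of a formula in a word. -/
def val (w : WordCode) : {n : ℕ} → Fm n → Val
  | n, .fls => flsVal n
  | n, .eq i j => eqVal w n i j
  | n, .lt i j => ltVal w n i j
  | n, .pr k i => prVal w n k i
  | _, .imp φ ψ => impVal w (val w φ) (val w ψ)
  | _, .all φ => allVal w (val w φ)

@[simp]
theorem val_fst (w : WordCode) {n : ℕ} (F : Fm n) : (val w F).1 = n := by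
  induction F with
  | imp φ ψ ih₁ ih₂ => exact ih₁
  | all φ ih => simp [val, allVal, ih]
  | _ => rfl

@[simp]
theorem val_tok (w : WordCode) {n : ℕ} (F : Fm n) : (val w F).2.1 = tok F := by
  induction F with
  | imp φ ψ ih₁ ih₂ => simp [val, impVal, tok, ih₁, ih₂]
  | all φ ih => simp [val, allVal, tok, ih]
  | _ => rfl

@[simp]
theorem val_bounds (w : WordCode) {n : ℕ} (F : Fm n) :
    (val w F).2.2.1 = (states F, letterBound F) := by
  induction F with
  | imp φ ψ ih₁ ih₂ => simp [val, impVal, states, letterBound, ih₁, ih₂]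
  | all φ ih => simp [val, allVal, states, letterBound, ih]
  | _ => rfl

theorem mem_val {w : WordCode} (hw : 0 < w.1) {n : ℕ} (F : Fm n) (e : ℕ) :
    e ∈ (val w F).2.2.2 ↔ e < w.1 ^ n ∧ Sat w.1 (dig w.2.1 w.2.2) F (dig w.1 e) := by
  induction F generalizing e with
  | fls => simp [val, flsVal, Sat]
  | eq i j => simp [val, eqVal, Sat]
  | lt i j => simp [val, ltVal, Sat]
  | pr k i => simp [val, prVal, Sat]
  | imp φ ψ ih₁ ih₂ =>
    simp only [val, impVal, val_fst, List.mem_filter, List.mem_range, decide_eq_true_eq, Sat, ih₁,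
      ih₂]
    tauto
  | @all n φ ih =>
    simp only [val, allVal, val_fst, List.mem_filter, List.mem_range, decide_eq_true_eq, Sat, ih,
      Nat.add_sub_cancel]
    refine and_congr_right fun he => forall₂_congr fun q hq => ?_
    rw [and_iff_right (add_mul_pow_lt he hq)]
    refine Sat.congr (fun _ _ _ _ => Iff.rfl) le_rfl (fun i hi => ?_) fun i _ => dig_lt hw _ _
    rcases eq_or_ne i n with rfl | hne
    · simpa using dig_add_mul_pow_self he hq
    · simpa [hne] using dig_add_mul_pow_of_lt hw (by omega)

theorem termArity_termTok (n i : ℕ) : termArity (termTok n i) = n := by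
  simp [termArity, termTok]

theorem termVar_termTok (n i : ℕ) : termVar (termTok n i) = i := by
  simp only [termVar, termTok, Nat.mul_div_cancel_left _ two_pos, Nat.unpair_pair,
    Nat.add_sub_cancel]
  omega

theorem parseTable_tok (w : WordCode) {n : ℕ} (F : Fm n) (l : List ℕ) :
    (parseTable w (tok F ++ l)).headI = val w F :: (parseTable w l).headI := by
  induction F generalizing l with
  | @fls n =>
    have h₁ : (4 * (n + 2) + 3) % 2 ≠ 0 := by omega
    have h₂ : (4 * (n + 2) + 3) / 4 = n + 2 := by omega
    simp [tok, parseTable, parseStep, h₁, h₂, val]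
  | @eq n i j =>
    have h₁ : termTok n i % 2 = 0 := by simp [termTok]
    simp [tok, parseTable, parseStep, h₁, termArity_termTok, termVar_termTok, val]
  | @lt n i j =>
    have h₁ : (4 * Nat.pair 2 0 + 1) % 2 ≠ 0 := by omega
    have h₂ : (4 * Nat.pair 2 0 + 1) % 4 = 1 := by omega
    have h₃ : (4 * Nat.pair 2 0 + 1) / 4 = Nat.pair 2 0 := by omega
    have h₄ : (4 * n + 3) / 4 = n := by omega
    simp only [tok, List.cons_append, List.nil_append, parseTable, List.headI_cons]
    simp [parseStep, h₁, h₂, h₃, h₄, termVar_termTok, val]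
  | @pr n k i =>
    have h₁ : (4 * Nat.pair 1 k + 1) % 2 ≠ 0 := by omega
    have h₂ : (4 * Nat.pair 1 k + 1) % 4 = 1 := by omega
    have h₃ : (4 * Nat.pair 1 k + 1) / 4 = Nat.pair 1 k := by omega
    have h₄ : (4 * n + 3) / 4 = n := by omega
    simp only [tok, List.cons_append, List.nil_append, parseTable, List.headI_cons]
    simp [parseStep, h₁, h₂, h₃, h₄, termVar_termTok, val]
  | imp φ ψ ih₁ ih₂ =>
    simp [tok, parseTable, parseStep, ih₁, ih₂, val]
  | all φ ih =>
    simp [tok, parseTable, parseStep, ih, val]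

theorem parseTable_sound (w : WordCode) (l : List ℕ) :
    ∀ s ∈ parseTable w l, ∀ v ∈ s, ∃ (n : ℕ) (F : Fm n), v = val w F := by
  have head : ∀ S : List (List Val), (∀ s ∈ S, ∀ v ∈ s, ∃ (n : ℕ) (F : Fm n), v = val w F) →
      ∀ v ∈ S.headI, ∃ (n : ℕ) (F : Fm n), v = val w F := by
    rintro (_ | ⟨s, S⟩) h v hv
    · exact absurd hv List.not_mem_nil
    · exact h s (by simp) v hv
  have tail : ∀ S : List (List Val), (∀ s ∈ S, ∀ v ∈ s, ∃ (n : ℕ) (F : Fm n), v = val w F) →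
      ∀ s ∈ S.tail, ∀ v ∈ s, ∃ (n : ℕ) (F : Fm n), v = val w F :=
    fun S h s hs => h s (List.mem_of_mem_tail hs)
  induction l with
  | nil => simp [parseTable]
  | cons t l ih =>
    intro s hs
    rcases List.mem_cons.1 hs with rfl | hs
    swap
    · exact ih s hs
    generalize parseTable w l = S at ih
    intro v hv
    unfold parseStep at hv
    split_ifs at hv with h₁ h₂ h₃ h₄ h₅ h₆ h₇ h₈ h₉ h₁₀
    · rcases List.mem_cons.1 hv with rfl | hv
      · exact ⟨_, .eq ⟨_, h₂.1⟩ ⟨_, h₂.2⟩, rfl⟩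
      · exact head _ (tail _ ih) v hv
    · simp at hv
    · rcases List.mem_cons.1 hv with rfl | hv
      · exact ⟨l.headI / 4, .pr (t / 4).unpair.2 ⟨_, h₅⟩, rfl⟩
      · exact head _ (tail _ (tail _ ih)) v hv
    · simp at hv
    · rcases List.mem_cons.1 hv with rfl | hv
      · exact ⟨_, .lt ⟨_, h₆.1⟩ ⟨_, h₆.2⟩, rfl⟩
      · exact head _ (tail _ (tail _ (tail _ ih))) v hv
    · simp at hv
    · have hS := head S ih
      rcases hS' : S.headI with _ | ⟨x, _ | ⟨y, r⟩⟩
      · simp [hS'] at h₈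
      · simp [hS'] at h₈
      rw [hS'] at hv hS h₈
      obtain ⟨n, F, rfl⟩ := hS x (by simp)
      obtain ⟨m, G, rfl⟩ := hS y (by simp)
      obtain rfl : n = m := by simpa using h₈
      rcases List.mem_cons.1 hv with rfl | hv
      · exact ⟨_, .imp F G, rfl⟩
      · exact hS v (by simp at hv; simp [hv])
    · simp at hv
    · have hS := head S ih
      rcases hS' : S.headI with _ | ⟨x, r⟩
      · simp [hS'] at h₁₀
      rw [hS'] at hv hS h₁₀
      obtain ⟨n, F, rfl⟩ := hS x (by simp)
      obtain _ | n := n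
      · simp at h₁₀
      rcases List.mem_cons.1 hv with rfl | hv
      · exact ⟨_, .all F, rfl⟩
      · exact hS v (by simp at hv; simp [hv])
    · simp at hv
    · rcases List.mem_cons.1 hv with rfl | hv
      · exact ⟨t / 4 - 2, .fls, rfl⟩
      · exact head S ih v hv

theorem tok_ne_nil {n : ℕ} (F : Fm n) : tok F ≠ [] := by
  cases F <;> simp [tok]

theorem codeVal_encode (w : WordCode) (F : Fm 0) :
    codeVal w (Encodable.encode (tok F)) = val w F := by
  have := parseTable_tok w F []
  rw [List.append_nil] at this
  rw [codeVal, Denumerable.ofNat_encode, this, List.headI_cons]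

theorem isCode_iff (c : ℕ) : IsCode c ↔ ∃ F : Fm 0, Encodable.encode (tok F) = c := by
  constructor
  · rintro ⟨hne, h0, ht⟩
    have hs := parseTable_sound (0, 0, 0) (Denumerable.ofNat (List ℕ) c)
    have hc : codeVal (0, 0, 0) c =
      (parseTable (0, 0, 0) (Denumerable.ofNat (List ℕ) c)).headI.headI := rfl
    rcases hS : parseTable (0, 0, 0) (Denumerable.ofNat (List ℕ) c) with _ | ⟨_ | ⟨v, s⟩, S⟩
    · rw [hc, hS] at ht
      exact absurd ht.symm hne
    · rw [hc, hS] at ht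
      exact absurd ht.symm hne
    · obtain ⟨n, F, rfl⟩ := hs _ (by rw [hS]; exact List.mem_cons_self) v List.mem_cons_self
      rw [hc, hS] at h0 ht
      obtain rfl : n = 0 := by simpa using h0
      refine ⟨F, ?_⟩
      have : tok F = Denumerable.ofNat (List ℕ) c := by simpa using ht
      rw [this, Denumerable.encode_ofNat]
  · rintro ⟨F, rfl⟩
    simp [IsCode, codeVal_encode, tok_ne_nil]

theorem agreeBounded_iff (F G : Fm 0) :
    AgreeBounded (Encodable.encode (tok F)) (Encodable.encode (tok G)) ↔
      ∀ L f, 0 < L → (Sat L f F 0 ↔ Sat L f G 0) := by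
  rw [forall_sat_iff_bounded]
  simp only [AgreeBounded, codeVal_encode, val_bounds]
  refine forall₃_congr fun L _ hL => forall₂_congr fun u _ => ?_
  have h0 : dig L 0 = 0 := by ext; simp [dig]
  rw [mem_val hL, mem_val hL]
  simp [h0]

end WordLogic

open WordLogic

/-- Equivalence over words is decidable: one can decide, given codes of two
`W`-sentences, whether they have exactly the same word models. -/
theorem wordEquiv_decidable :
    ComputablePred fun p : ℕ × ℕ => ∃ φ ψ : W.Sentence,
      Encodable.encode φ = p.1 ∧ Encodable.encode ψ = p.2 ∧
      ∀ (M : Type) (_ : W.Structure M), IsWord M → (M ⊨ φ ↔ M ⊨ ψ) := by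
  refine PrimrecPred.computablePred (((primrecPred_isCode .fst).and
    ((primrecPred_isCode .snd).and (primrecPred_agreeBounded .fst .snd))).of_eq ?_)
  rintro ⟨c, d⟩
  simp only [isCode_iff]
  constructor
  · rintro ⟨⟨F, rfl⟩, ⟨G, rfl⟩, h⟩
    exact ⟨F.toBF, G.toBF, encode_toBF F, encode_toBF G,
      (forall_word_iff F G).2 ((agreeBounded_iff F G).1 h)⟩
  · rintro ⟨φ, ψ, rfl, rfl, h⟩
    obtain ⟨F, rfl⟩ := Fm.toBF_surjective φ
    obtain ⟨G, rfl⟩ := Fm.toBF_surjective ψ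
    refine ⟨⟨F, (encode_toBF F).symm⟩, ⟨G, (encode_toBF G).symm⟩, ?_⟩
    rw [encode_toBF, encode_toBF]
    exact (agreeBounded_iff F G).2 ((forall_word_iff F G).1 h)
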